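/- There are absolute constants C > 0 and t₀ such that for all integers t ≥ t₀ and m ≥ n ≥ t, if (X, Σ) is a random t-sparse set system with |X| = n and |Σ| = m, then with probability at least 1 − 2^{−t} one has herdisc(Σ) ≤ C·√(t·log t). -/

import Mathlib

open Finset

open scoped Classical

/-- The discrepancy of a set system `S : Fin m → Finset (Fin n)`. -/
noncomputable def disc {n m : ℕ} (S : Fin m → Finset (Fin n)) : ℕ :=
  sInf {d : ℕ | ∃ χ : Fin n → ℤ, (∀ x, χ x = 1 ∨ χ x = -1) ∧
    ∀ i : Fin m, (∑ x ∈ S i, χ x).natAbs ≤ d}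

/-- The hereditary discrepancy: the maximum of `disc` over restrictions to `Y ⊆ X`. -/
noncomputable def herdisc {n m : ℕ} (S : Fin m → Finset (Fin n)) : ℕ :=
  Finset.univ.sup fun Y : Finset (Fin n) => disc fun i => S i ∩ Y

/-- The sample space of a random `t`-sparse set system: each element `x ∈ X`
independently gets a uniformly random `t`-element subset `T x ⊆ [m]` of set indices.
The uniform distribution on this finite set is the distribution of the random system. -/
noncomputable def sparseChoices (n m t : ℕ) : Finset (Fin n → Finset (Fin m)) :=
  Finset.univ.filter fun T => ∀ x, (T x).card = t

/-- The set system determined by membership choices `T`: `S_i = {x : i ∈ T x}`. -/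
noncomputable def setsOf {n m : ℕ} (T : Fin n → Finset (Fin m)) : Fin m → Finset (Fin n) :=
  fun i => Finset.univ.filter fun x => i ∈ T x

/-- The symmetric Lovász local lemma on a finite set of outcomes, in counting form. -/
theorem exists_forall_not_of_local_lemma {Ω ι : Type*} [Fintype Ω] [Nonempty Ω] [Fintype ι]
    (P : ι → Ω → Prop) (Γ : ι → Finset ι) (p : ℝ) (d : ℕ) (hd : 1 ≤ d)
    (hΓ : ∀ i, #(Γ i) ≤ d) (hp : 0 ≤ p) (hpd : 4 * p * d ≤ 1)
    (hind : ∀ i, ∀ S : Finset ι, Disjoint S (Γ i) →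
      (#{ω | P i ω ∧ ∀ j ∈ S, ¬ P j ω} : ℝ) ≤ p * #{ω | ∀ j ∈ S, ¬ P j ω}) :
    ∃ ω, ∀ i, ¬ P i ω := by
  have hd' : (1 : ℝ) ≤ d := by exact_mod_cast hd
  have key : ∀ S : Finset ι, ∀ i,
      (#{ω | P i ω ∧ ∀ j ∈ S, ¬ P j ω} : ℝ) ≤ 2 * p * #{ω | ∀ j ∈ S, ¬ P j ω} := by
    intro S
    induction S using Finset.strongInduction with
    | H S ih =>
      intro i
      by_cases hS : Disjoint S (Γ i)
      · refine (hind i S hS).trans ?_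
        have : 0 ≤ p * (#{ω | ∀ j ∈ S, ¬ P j ω} : ℝ) := by positivity
        linarith
      · have hss : S \ Γ i ⊂ S := by
          refine ⟨sdiff_subset, fun h => hS ?_⟩
          rw [Finset.disjoint_left]
          exact fun x hx => (mem_sdiff.1 (h hx)).2
        have h1 := hind i (S \ Γ i) sdiff_disjoint
        have h2 : (#{ω | P i ω ∧ ∀ j ∈ S, ¬ P j ω} : ℝ)
            ≤ #{ω | P i ω ∧ ∀ j ∈ S \ Γ i, ¬ P j ω} := by
          refine Nat.cast_le.2 (card_le_card fun ω => ?_)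
          simp only [mem_filter, mem_univ, true_and, mem_sdiff]
          exact fun h => ⟨h.1, fun j hj => h.2 j hj.1⟩
        have h3 : (#{ω | ∀ j ∈ S \ Γ i, ¬ P j ω} : ℝ) ≤ #{ω | ∀ j ∈ S, ¬ P j ω} +
            ∑ k ∈ Γ i, (#{ω | P k ω ∧ ∀ j ∈ S \ Γ i, ¬ P j ω} : ℝ) := by
          have : ({ω | ∀ j ∈ S \ Γ i, ¬ P j ω} : Finset Ω) ⊆ ({ω | ∀ j ∈ S, ¬ P j ω} : Finset Ω) ∪
              (Γ i).biUnion fun k => {ω | P k ω ∧ ∀ j ∈ S \ Γ i, ¬ P j ω} := by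
            intro ω
            simp only [mem_filter, mem_univ, true_and, mem_sdiff, mem_union, mem_biUnion]
            intro h
            by_cases h' : ∃ k ∈ Γ i, P k ω
            · obtain ⟨k, hk, hk'⟩ := h'
              exact Or.inr ⟨k, hk, hk', h⟩
            · push Not at h'
              refine Or.inl fun j hj => ?_
              by_cases hj' : j ∈ Γ i
              · exact h' j hj'
              · exact h j ⟨hj, hj'⟩
          have := (card_le_card this).trans
            ((card_union_le _ _).trans (Nat.add_le_add_left card_biUnion_le _))
          exact_mod_cast this
        have h4 : ∑ k ∈ Γ i, (#{ω | P k ω ∧ ∀ j ∈ S \ Γ i, ¬ P j ω} : ℝ) ≤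
            d * (2 * p * #{ω | ∀ j ∈ S \ Γ i, ¬ P j ω}) := by
          refine (sum_le_card_nsmul _ _ _ fun k _ => ih _ hss k).trans ?_
          rw [nsmul_eq_mul]
          have := hΓ i
          gcongr
        have h5 : 0 ≤ (#{ω | ∀ j ∈ S \ Γ i, ¬ P j ω} : ℝ) := by positivity
        nlinarith [mul_le_mul_of_nonneg_right hpd h5]
  have pos : ∀ S : Finset ι, 0 < (#{ω | ∀ j ∈ S, ¬ P j ω} : ℝ) := by
    intro S
    induction S using Finset.induction_on with
    | empty => simpa using Fintype.card_pos
    | insert i S _ ih =>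
      have h1 := key S i
      have h2 : (#{ω | ∀ j ∈ S, ¬ P j ω} : ℝ) ≤ #{ω | P i ω ∧ ∀ j ∈ S, ¬ P j ω} +
          #{ω | ∀ j ∈ insert i S, ¬ P j ω} := by
        rw [← Nat.cast_add, Nat.cast_le]
        refine le_trans (card_le_card fun ω => ?_) (card_union_le _ _)
        simp only [mem_filter, mem_univ, true_and, mem_union, forall_mem_insert]
        tauto
      have h3 : 2 * p ≤ 1 / 2 := by nlinarith
      nlinarith
  obtain ⟨ω, hω⟩ := card_pos.1 (Nat.cast_pos.1 (pos univ))
  exact ⟨ω, fun i => (mem_filter.1 hω).2 i (mem_univ i)⟩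

theorem card_filter_and_mul_card_eq {V β : Type*} [Fintype V] [Fintype β]
    (A B : Finset V) (hAB : Disjoint A B) (P Q : (V → β) → Prop)
    (hP : ∀ ω ω', (∀ v ∈ A, ω v = ω' v) → P ω → P ω')
    (hQ : ∀ ω ω', (∀ v ∈ B, ω v = ω' v) → Q ω → Q ω') :
    #{ω | P ω ∧ Q ω} * Fintype.card (V → β) = #{ω | P ω} * #{ω | Q ω} := by
  rw [← card_univ, ← card_product, ← card_product]
  let F : (V → β) × (V → β) → (V → β) × (V → β) := fun z =>
    (fun v => if v ∈ A then z.1 v else z.2 v, fun v => if v ∈ A then z.2 v else z.1 v)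
  have hF : ∀ z, F (F z) = z := by
    intro z
    ext v <;> simp only [F] <;> split_ifs <;> rfl
  have hB : ∀ v ∈ B, v ∉ A := fun v hv hv' => Finset.disjoint_left.1 hAB hv' hv
  refine card_nbij' F F ?_ ?_ (fun z _ => hF z) (fun z _ => hF z)
  · intro z
    simp only [coe_product, coe_filter, mem_univ, true_and, Set.mem_prod, Set.mem_ofPred_eq,
      coe_univ, Set.mem_univ, and_true]
    refine fun h => ⟨hP _ _ (fun v hv => ?_) h.1, hQ _ _ (fun v hv => ?_) h.2⟩
    · simp [F, hv]
    · simp [F, hB v hv]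
  · intro z
    simp only [coe_product, coe_filter, mem_univ, true_and, Set.mem_prod, Set.mem_ofPred_eq,
      coe_univ, Set.mem_univ, and_true]
    refine fun h => ⟨hP _ _ (fun v hv => ?_) h.1, hQ _ _ (fun v hv => ?_) h.2⟩
    · simp [F, hv]
    · simp [F, hB v hv]

/-- The local lemma for events on a product space which are determined by few coordinates. -/
theorem exists_forall_not_of_local_lemma_pi {V β ι : Type*} [Fintype V] [Fintype β] [Nonempty β]
    [Fintype ι] (P : ι → (V → β) → Prop) (vbl : ι → Finset V)
    (hP : ∀ i ω ω', (∀ v ∈ vbl i, ω v = ω' v) → P i ω → P i ω')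
    (p : ℝ) (d : ℕ) (hd : 1 ≤ d) (hΓ : ∀ i, #{j | ¬ Disjoint (vbl i) (vbl j)} ≤ d)
    (hp : 0 ≤ p) (hpd : 4 * p * d ≤ 1)
    (hprob : ∀ i, (#{ω | P i ω} : ℝ) ≤ p * Fintype.card (V → β)) :
    ∃ ω, ∀ i, ¬ P i ω := by
  refine exists_forall_not_of_local_lemma P (fun i => {j | ¬ Disjoint (vbl i) (vbl j)}) p d hd hΓ
    hp hpd fun i S hS => ?_
  have hdisj : Disjoint (vbl i) (S.biUnion vbl) := by
    rw [disjoint_biUnion_right]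
    intro j hj
    have := Finset.disjoint_left.1 hS hj
    simpa using this
  have h := card_filter_and_mul_card_eq (vbl i) (S.biUnion vbl) hdisj (P i)
    (fun ω => ∀ j ∈ S, ¬ P j ω) (hP i) fun ω ω' hωω' hω j hj hj' =>
      hω j hj (hP j ω' ω (fun v hv => (hωω' v (mem_biUnion.2 ⟨j, hj, hv⟩)).symm) hj')
  have hpos : (0 : ℝ) < Fintype.card (V → β) := by exact_mod_cast Fintype.card_pos
  refine le_of_mul_le_mul_right ?_ hpos
  have h' : (#{ω | P i ω ∧ ∀ j ∈ S, ¬ P j ω} : ℝ) * Fintype.card (V → β) =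
      #{ω | P i ω} * #{ω | ∀ j ∈ S, ¬ P j ω} := by
    rw [← Nat.cast_mul, ← Nat.cast_mul, Nat.cast_inj]
    convert h
  rw [h']
  calc _ ≤ p * Fintype.card (V → β) * (#{ω | ∀ j ∈ S, ¬ P j ω} : ℝ) := by
        gcongr
        exact hprob i
    _ = _ := by ring

/-- The sign `±1` encoded by a bit. -/
def signOf (b : Bool) : ℤ := if b then 1 else -1

theorem signOf_eq (b : Bool) : signOf b = 1 ∨ signOf b = -1 := by
  cases b <;> simp [signOf]

theorem sum_exp_signed_sum_le {V : Type*} [Fintype V] (c : V → ℝ) :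
    ∑ ω : V → Bool, Real.exp (∑ v, c v * signOf (ω v)) ≤
      Fintype.card (V → Bool) * Real.exp ((∑ v, c v ^ 2) / 2) := by
  simp_rw [Real.exp_sum]
  rw [← Fintype.piFinset_univ, ← Finset.prod_univ_sum (fun _ => univ)
    (fun v b => Real.exp (c v * signOf b))]
  have h : ∀ v, ∑ b : Bool, Real.exp (c v * signOf b) ≤ 2 * Real.exp (c v ^ 2 / 2) := by
    intro v
    have := Real.cosh_le_exp_half_sq (c v)
    rw [Real.cosh_eq] at this
    simp only [Fintype.sum_bool, signOf]
    simp
    linarith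
  refine (prod_le_prod (fun v _ => by positivity) fun v _ => h v).trans ?_
  rw [prod_mul_distrib, ← Real.exp_sum, sum_div]
  simp

theorem card_lt_signed_sum_le {V : Type*} [Fintype V] (c : V → ℝ) (a lam : ℝ) (ha : 0 < a)
    (hlam : 0 ≤ lam) (hc : ∑ v, c v ^ 2 ≤ 2 * a) :
    (#{ω : V → Bool | lam < ∑ v, c v * signOf (ω v)} : ℝ) ≤
      Real.exp (-(lam ^ 2 / (4 * a))) * Fintype.card (V → Bool) := by
  set th := lam / (2 * a) with hth
  have hth0 : 0 ≤ th := by positivity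
  have h := sum_exp_signed_sum_le fun v => th * c v
  have h1 : (#{ω : V → Bool | lam < ∑ v, c v * signOf (ω v)} : ℝ) * Real.exp (th * lam) ≤
      ∑ ω : V → Bool, Real.exp (∑ v, th * c v * signOf (ω v)) := by
    rw [← nsmul_eq_mul]
    refine (card_nsmul_le_sum _ _ _ fun ω hω => ?_).trans
      (sum_le_sum_of_subset_of_nonneg (subset_univ _) fun _ _ _ => by positivity)
    rw [mem_filter] at hω
    simp_rw [mul_assoc, ← mul_sum]
    gcongr
    exact hω.2.le
  have h2 : (∑ v, (th * c v) ^ 2) / 2 ≤ th ^ 2 * a := by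
    simp_rw [mul_pow, ← mul_sum]
    nlinarith [mul_le_mul_of_nonneg_left hc (sq_nonneg th)]
  have h3 : -(lam ^ 2 / (4 * a)) = th ^ 2 * a - th * lam := by
    rw [hth]; field_simp; ring
  rw [h3, Real.exp_sub, div_mul_eq_mul_div, le_div_iff₀ (Real.exp_pos _)]
  refine (h1.trans h).trans ?_
  rw [mul_comm]
  gcongr

theorem card_lt_abs_signed_sum_le {V : Type*} [Fintype V] (c : V → ℝ) (a lam : ℝ) (ha : 0 < a)
    (hlam : 0 ≤ lam) (hc : ∑ v, c v ^ 2 ≤ 2 * a) :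
    (#{ω : V → Bool | lam < |∑ v, c v * signOf (ω v)|} : ℝ) ≤
      2 * Real.exp (-(lam ^ 2 / (4 * a))) * Fintype.card (V → Bool) := by
  have h1 := card_lt_signed_sum_le c a lam ha hlam hc
  have h2 := card_lt_signed_sum_le (fun v => - c v) a lam ha hlam (by simpa using hc)
  have h3 : (#{ω : V → Bool | lam < |∑ v, c v * signOf (ω v)|} : ℝ) ≤
      #{ω : V → Bool | lam < ∑ v, c v * signOf (ω v)} +
      #{ω : V → Bool | lam < ∑ v, -c v * signOf (ω v)} := by
    rw [← Nat.cast_add, Nat.cast_le]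
    refine le_trans (card_le_card fun ω => ?_) (card_union_le _ _)
    simp only [mem_filter, mem_univ, true_and, mem_union, neg_mul, sum_neg_distrib]
    exact lt_abs.1
  linarith

/-- The subgaussian tail for a signed sum in which every random sign is used at most twice. -/
theorem card_lt_abs_sum_fiber_le {α V : Type*} [Fintype V] (R : Finset α) (g : α → V)
    (sg : α → ℤ) (hsg : ∀ x, sg x = 1 ∨ sg x = -1) (hg : ∀ v, #{x ∈ R | g x = v} ≤ 2)
    (a lam : ℝ) (ha : 0 < a) (hlam : 0 ≤ lam) (hR : (#R : ℝ) ≤ a) :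
    (#{ω : V → Bool | lam < |((∑ x ∈ R, sg x * signOf (ω (g x)) : ℤ) : ℝ)|} : ℝ) ≤
      2 * Real.exp (-(lam ^ 2 / (4 * a))) * Fintype.card (V → Bool) := by
  let c : V → ℝ := fun v => ∑ x ∈ R with g x = v, (sg x : ℝ)
  have hsum : ∀ ω : V → Bool,
      ((∑ x ∈ R, sg x * signOf (ω (g x)) : ℤ) : ℝ) = ∑ v, c v * signOf (ω v) := by
    intro ω
    push_cast
    rw [← sum_fiberwise R g]
    refine sum_congr rfl fun v _ => ?_
    simp only [c, sum_mul]
    exact sum_congr rfl fun x hx => by rw [(mem_filter.1 hx).2]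
  have habs : ∀ v, |c v| ≤ #{x ∈ R | g x = v} := by
    intro v
    refine (abs_sum_le_sum_abs _ _).trans ?_
    rw [card_eq_sum_ones, Nat.cast_sum]
    exact sum_le_sum fun x _ => by rcases hsg x with h | h <;> simp [h]
  simp_rw [hsum]
  refine card_lt_abs_signed_sum_le c a lam ha hlam ?_
  calc ∑ v, c v ^ 2 ≤ ∑ v, 2 * (#{x ∈ R | g x = v} : ℝ) := by
        refine sum_le_sum fun v _ => ?_
        have h2 : (#{x ∈ R | g x = v} : ℝ) ≤ 2 := by exact_mod_cast hg v
        rw [← sq_abs]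
        nlinarith [habs v, abs_nonneg (c v)]
    _ = 2 * #R := by
        rw [← mul_sum, ← Nat.cast_sum,
          card_eq_sum_card_fiberwise (f := g) (t := univ) fun _ _ => mem_coe.2 (mem_univ _)]
    _ ≤ 2 * a := by linarith

theorem exists_pairing {α : Type*} (A : Finset α) :
    ∃ (g : α → α) (sg : α → ℤ), (∀ x, sg x = 1 ∨ sg x = -1) ∧ (∀ x ∈ A, g x ∈ A) ∧
      (∀ v, #{x ∈ A | g x = v} ≤ 2) ∧
      ∀ w : α → ℤ, (∀ v, |w v| ≤ 1) → |∑ x ∈ A, sg x * w (g x)| ≤ 1 := by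
  induction A using Finset.strongInduction with
  | H A ih =>
    by_cases hA : #A ≤ 1
    · refine ⟨id, fun _ => 1, by simp, by simp, fun v => ?_, fun w hw => ?_⟩
      · exact (card_filter_le _ _).trans (by omega)
      · obtain rfl | hne := A.eq_empty_or_nonempty
        · simp
        · obtain ⟨a, rfl⟩ := card_eq_one.1 (hA.antisymm hne.card_pos)
          simpa using hw a
    · obtain ⟨a, ha, b, hb, hab⟩ := one_lt_card.1 (not_le.1 hA)
      obtain ⟨g, sg, h1, h2, h3, h4⟩ := ih ((A.erase b).erase a)
        (((erase_ssubset (mem_erase.2 ⟨hab, ha⟩))).trans (erase_ssubset hb))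
      set A' := (A.erase b).erase a with hA'
      have haA' : a ∉ A' := by simp [hA']
      have hbA' : b ∉ insert a A' := by simp [hA', hab.symm]
      have hAeq : A = insert b (insert a A') := by
        rw [hA', insert_erase (mem_erase.2 ⟨hab, ha⟩), insert_erase hb]
      refine ⟨fun x => if x = a ∨ x = b then a else g x,
        fun x => if x = a then 1 else if x = b then -1 else sg x, fun x => ?_, fun x hx => ?_,
        fun v => ?_, fun w hw => ?_⟩
      · dsimp only
        split_ifs <;> simp [h1]
      · dsimp only
        split_ifs with h
        · exact ha
        · push Not at h
          have : x ∈ A' := by simp [hA', h, hx]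
          exact mem_of_mem_erase (mem_of_mem_erase (h2 x this))
      · by_cases hv : v = a
        · refine (card_le_card (t := {a, b}) fun x hx => ?_).trans card_le_two
          obtain ⟨hx, hx'⟩ := mem_filter.1 hx
          by_contra hcon
          simp only [mem_insert, mem_singleton] at hcon
          simp only [hcon, if_false] at hx'
          push Not at hcon
          have hxA : x ∈ A' := by simp [hA', hcon, hx]
          exact haA' (hv ▸ hx' ▸ h2 x hxA)
        · refine (card_le_card fun x hx => ?_).trans (h3 v)
          obtain ⟨hx, hx'⟩ := mem_filter.1 hx
          by_cases hcon : x = a ∨ x = b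
          · simp only [hcon, if_true] at hx'
            exact absurd hx'.symm hv
          · simp only [hcon, if_false] at hx'
            push Not at hcon
            exact mem_filter.2 ⟨by simp [hA', hcon, hx], hx'⟩
      · rw [hAeq, sum_insert hbA', sum_insert haA']
        have : ∑ x ∈ A', (if x = a then 1 else if x = b then -1 else sg x) *
            w (if x = a ∨ x = b then a else g x) = ∑ x ∈ A', sg x * w (g x) := by
          refine sum_congr rfl fun x hx => ?_
          have hxa : x ≠ a := fun h => haA' (h ▸ hx)
          have hxb : x ≠ b := fun h => hbA' (h ▸ mem_insert_of_mem hx)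
          simp [hxa, hxb]
        rw [this]
        simpa [hab.symm] using h4 w hw

/-- If every set can be cut, by an assignment `f` of elements to sets, down to a part of a
disjoint family plus at most `s` further elements, then all restrictions have small discrepancy. -/
theorem exists_coloring_of_assignment {α ι : Type*} [Fintype α] [Fintype ι] (T : α → Finset ι)
    (t s : ℕ) (ht : 1 ≤ t) (hs : 1 ≤ s) (hT : ∀ x, #(T x) ≤ t) (f : α → ι)
    (hfT : ∀ x, f x ∈ T x) (hf : ∀ i, #{x | i ∈ T x ∧ f x ≠ i} ≤ s) (lam : ℝ) (hlam : 0 ≤ lam)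
    (hsmall : 4 * (2 * Real.exp (-(lam ^ 2 / (4 * s)))) * (s * (2 * t) : ℕ) ≤ 1) (Y : Finset α) :
    ∃ χ : α → ℤ, (∀ x, χ x = 1 ∨ χ x = -1) ∧
      ∀ i, |((∑ x ∈ Y with i ∈ T x, χ x : ℤ) : ℝ)| ≤ lam + 1 := by
  choose g sg hsg hgA hg2 hbal using fun i => exists_pairing ({x ∈ Y | f x = i} : Finset α)
  let G : α → α := fun x => g (f x) x
  let R : ι → Finset α := fun i => {x ∈ Y | i ∈ T x ∧ f x ≠ i}
  have hRcard : ∀ i, #(R i) ≤ s := fun i =>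
    (card_le_card (filter_subset_filter _ (subset_univ Y))).trans (hf i)
  have hG : ∀ v, #{x ∈ Y | G x = v} ≤ 2 := by
    intro v
    refine (card_le_card fun x hx => ?_).trans (hg2 (f v) v)
    obtain ⟨hxY, hxv⟩ := mem_filter.1 hx
    have hfv : f v = f x := by
      have := hgA (f x) x (mem_filter.2 ⟨hxY, rfl⟩)
      exact hxv ▸ (mem_filter.1 this).2
    rw [mem_filter, mem_filter, hfv]
    exact ⟨⟨hxY, rfl⟩, hxv⟩
  obtain ⟨ω, hω⟩ := exists_forall_not_of_local_lemma_pi (V := α) (β := Bool)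
    (fun i ω => lam < |((∑ x ∈ R i, sg (f x) x * signOf (ω (G x)) : ℤ) : ℝ)|)
    (fun i => (R i).image G) (fun i ω ω' h hlt => by
      rw [sum_congr rfl fun x hx => by rw [← h (G x) (mem_image_of_mem G hx)]]
      exact hlt)
    (2 * Real.exp (-(lam ^ 2 / (4 * s)))) (s * (2 * t)) (Nat.mul_pos hs (by omega))
    (fun i => by
      refine (card_le_card (t := (R i).biUnion fun x => ({y ∈ Y | G y = G x} : Finset α).biUnion T)
        fun j hj => ?_).trans ?_
      · obtain ⟨v, hv, hv'⟩ := not_disjoint_iff.1 (mem_filter.1 hj).2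
        obtain ⟨x, hx, rfl⟩ := mem_image.1 hv
        obtain ⟨y, hy, hyx⟩ := mem_image.1 hv'
        obtain ⟨hyY, hyT, -⟩ := mem_filter.1 hy
        exact mem_biUnion.2 ⟨x, hx, mem_biUnion.2 ⟨y, mem_filter.2 ⟨hyY, hyx⟩, hyT⟩⟩
      · refine (card_biUnion_le_card_mul _ _ (2 * t) fun x _ => ?_).trans
          (Nat.mul_le_mul_right _ (hRcard i))
        exact (card_biUnion_le_card_mul _ _ t fun y _ => hT y).trans
          (Nat.mul_le_mul_right _ (hG _)))
    (by positivity) hsmall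
    (fun i => by
      refine card_lt_abs_sum_fiber_le (R i) G (fun x => sg (f x) x) (fun x => hsg _ _)
        (fun v => (card_le_card fun x hx => ?_).trans (hG v)) s lam (by positivity) hlam
        (by exact_mod_cast hRcard i)
      obtain ⟨hx, hxv⟩ := mem_filter.1 hx
      exact mem_filter.2 ⟨(mem_filter.1 hx).1, hxv⟩)
  refine ⟨fun x => sg (f x) x * signOf (ω (G x)), fun x => ?_, fun i => ?_⟩
  · rcases hsg (f x) x with h | h <;> rcases signOf_eq (ω (G x)) with h' | h' <;> simp [h, h']
  · have hsplit : ∑ x ∈ Y with i ∈ T x, sg (f x) x * signOf (ω (G x)) =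
        ∑ x ∈ R i, sg (f x) x * signOf (ω (G x)) +
          ∑ x ∈ Y with f x = i, sg i x * signOf (ω (g i x)) := by
      rw [← sum_filter_add_sum_filter_not (s := ({x ∈ Y | i ∈ T x} : Finset α)) (fun x => f x ≠ i),
        filter_filter, filter_filter]
      congr 1
      refine sum_congr ?_ fun x hx => ?_
      · ext x
        simp only [mem_filter, not_not]
        exact ⟨fun h => ⟨h.1, h.2.2⟩, fun h => ⟨h.1, h.2 ▸ hfT x, h.2⟩⟩
      · rw [← (mem_filter.1 hx).2]
    have h1 := not_lt.1 (hω i)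
    have h2 := hbal i (fun v => signOf (ω v)) fun v => by
      rcases signOf_eq (ω v) with h | h <;> simp [h]
    have h2' : |((∑ x ∈ Y with f x = i, sg i x * signOf (ω (g i x)) : ℤ) : ℝ)| ≤ 1 := by
      exact_mod_cast h2
    rw [hsplit, Int.cast_add]
    exact (abs_add_le _ _).trans (add_le_add h1 h2')

/-- Hall's theorem turned into a criterion for assigning each element to one of its sets in such a
way that every set loses at most `s` elements. -/
theorem exists_assignment {α ι : Type*} [Fintype α] [Fintype ι] (T : α → Finset ι)
    (s : ℕ) (hT : ∀ x, (T x).Nonempty)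
    (hJ : ∀ J : Finset ι, ∑ x, (#(T x ∩ J) - 1) ≤ s * #J) :
    ∃ f : α → ι, (∀ x, f x ∈ T x) ∧ ∀ i, #{x | i ∈ T x ∧ f x ≠ i} ≤ s := by
  let S : ι → Finset α := fun i => {x | i ∈ T x}
  obtain ⟨h, hinj, hmem⟩ := (all_card_le_biUnion_card_iff_exists_injective
    (fun p : (i : ι) × Fin (#(S i) - s) => S p.1)).1 fun U => by
      let J : Finset ι := U.image Sigma.fst
      have h1 : #U ≤ ∑ i ∈ J, (#(S i) - s) := by
        refine (card_le_card (t := J.sigma fun i => univ) fun p hp => ?_).trans ?_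
        · exact mem_sigma.2 ⟨mem_image_of_mem _ hp, mem_univ _⟩
        · simp [card_sigma]
      have h2 : ∑ i ∈ J, (#(S i) - s) + s * #J = ∑ i ∈ J, #(S i) := by
        rw [mul_comm, ← smul_eq_mul, ← sum_const, ← sum_add_distrib]
        refine sum_congr rfl fun i hi => Nat.sub_add_cancel ?_
        obtain ⟨p, -, rfl⟩ := mem_image.1 hi
        have := p.2.2
        omega
      have h3 : ∑ i ∈ J, #(S i) = ∑ x, #(T x ∩ J) := by
        simp_rw [S, card_filter]
        rw [sum_comm]
        refine sum_congr rfl fun x _ => ?_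
        rw [← card_filter, inter_comm, filter_mem_eq_inter]
      have h4 : ∑ x, #(T x ∩ J) ≤ ∑ x, (#(T x ∩ J) - 1) + #(U.biUnion fun p => S p.1) := by
        have : #(U.biUnion fun p => S p.1) = ∑ x, if x ∈ U.biUnion fun p => S p.1 then 1 else 0 := by
          rw [← card_filter, filter_univ_mem]
        rw [this, ← sum_add_distrib]
        refine sum_le_sum fun x _ => ?_
        split_ifs with hx
        · omega
        · have : T x ∩ J = ∅ := by
            refine eq_empty_of_forall_notMem fun i hi => hx ?_
            obtain ⟨hi, hi'⟩ := mem_inter.1 hi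
            obtain ⟨p, hp, rfl⟩ := mem_image.1 hi'
            exact mem_biUnion.2 ⟨p, hp, by simpa [S] using hi⟩
          simp [this]
      have := hJ J
      omega
  have hex : ∀ x, ∃ i, i ∈ T x ∧ ∀ p, h p = x → p.1 = i := by
    intro x
    by_cases hx : ∃ p, h p = x
    · obtain ⟨p, rfl⟩ := hx
      exact ⟨p.1, by simpa [S] using hmem p, fun q hq => by rw [hinj hq]⟩
    · exact ⟨(hT x).choose, (hT x).choose_spec, fun p hp => absurd ⟨p, hp⟩ hx⟩
  choose f hfT hfp using hex
  refine ⟨f, hfT, fun i => ?_⟩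
  have h1 : #(S i) - s ≤ #{x ∈ S i | f x = i} := by
    have := card_le_card_of_injOn (s := (univ : Finset (Fin (#(S i) - s))))
      (t := {x ∈ S i | f x = i}) (fun k => h ⟨i, k⟩)
      (fun k _ => mem_coe.2 (mem_filter.2 ⟨hmem ⟨i, k⟩, (hfp _ _ rfl).symm⟩))
      (fun k _ l _ hkl => by simpa using hinj hkl)
    simpa using this
  have h2 := card_filter_add_card_filter_not (s := S i) (fun x => f x = i)
  have h3 : #{x | i ∈ T x ∧ f x ≠ i} = #{x ∈ S i | ¬ f x = i} := by
    rw [filter_filter]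
  omega

theorem herdisc_le_of_forall_coloring {n m : ℕ} (S : Fin m → Finset (Fin n)) (D : ℝ) (hD : 0 ≤ D)
    (h : ∀ Y : Finset (Fin n), ∃ χ : Fin n → ℤ, (∀ x, χ x = 1 ∨ χ x = -1) ∧
      ∀ i, |((∑ x ∈ S i ∩ Y, χ x : ℤ) : ℝ)| ≤ D) : (herdisc S : ℝ) ≤ D := by
  refine le_trans (Nat.cast_le.2 (Finset.sup_le fun Y _ => ?_)) (Nat.floor_le hD)
  obtain ⟨χ, hχ, hD'⟩ := h Y
  refine Nat.sInf_le ⟨χ, hχ, fun i => Nat.le_floor ?_⟩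
  rw [Nat.cast_natAbs, Int.cast_abs]
  exact hD' i

/-- The deterministic part: a sparsity condition on the incidences bounds the hereditary
discrepancy. -/
theorem herdisc_setsOf_le {n m : ℕ} (T : Fin n → Finset (Fin m)) (t s : ℕ) (ht : 1 ≤ t)
    (hs : 1 ≤ s) (hT : ∀ x, #(T x) = t) (hJ : ∀ J, ∑ x, (#(T x ∩ J) - 1) ≤ s * #J)
    (lam : ℝ) (hlam : 0 ≤ lam)
    (hsmall : 4 * (2 * Real.exp (-(lam ^ 2 / (4 * s)))) * (s * (2 * t) : ℕ) ≤ 1) :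
    (herdisc (setsOf T) : ℝ) ≤ lam + 1 := by
  obtain ⟨f, hfT, hf⟩ := exists_assignment T s (fun x => card_pos.1 (by rw [hT x]; exact ht))
    fun J => by convert hJ J
  refine herdisc_le_of_forall_coloring _ _ (by positivity) fun Y => ?_
  obtain ⟨χ, hχ, hχ'⟩ := exists_coloring_of_assignment T t s ht hs (fun x => (hT x).le) f hfT
    (fun i => by convert hf i) lam hlam hsmall Y
  refine ⟨χ, hχ, fun i => ?_⟩
  convert hχ' i using 5
  ext x
  simp [setsOf, and_comm]

theorem choose_sub_mul_pow_le {m t : ℕ} (htm : t ≤ m) (b : ℕ) (hb : b ≤ t) :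
    (m - b).choose (t - b) * m ^ b ≤ m.choose t * t ^ b := by
  induction b with
  | zero => simp
  | succ b ih =>
    have ih := ih (by omega)
    obtain ⟨u, rfl⟩ : ∃ u, t = b + 1 + u := ⟨t - (b + 1), by omega⟩
    obtain ⟨v, rfl⟩ : ∃ v, m = b + 1 + u + v := ⟨m - (b + 1 + u), by omega⟩
    have e1 : b + 1 + u + v - b = u + v + 1 := by omega
    have e2 : b + 1 + u - b = u + 1 := by omega
    have e3 : b + 1 + u + v - (b + 1) = u + v := by omega
    have e4 : b + 1 + u - (b + 1) = u := by omega
    rw [e1, e2] at ih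
    rw [e3, e4]
    have h := Nat.add_one_mul_choose_eq (u + v) u
    have h1 : (u + v).choose u * (b + 1 + u + v) ≤ (u + v + 1).choose (u + 1) * (b + 1 + u) := by
      refine le_of_mul_le_mul_left (a := u + v + 1) ?_ (Nat.succ_pos _)
      calc (u + v + 1) * ((u + v).choose u * (b + 1 + u + v))
          = (u + v + 1).choose (u + 1) * ((u + 1) * (b + 1 + u + v)) := by
            rw [← mul_assoc, h, mul_assoc]
        _ ≤ (u + v + 1).choose (u + 1) * ((u + v + 1) * (b + 1 + u)) := by
            refine Nat.mul_le_mul_left _ ?_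
            nlinarith [Nat.zero_le (v * b)]
        _ = _ := by ring
    calc (u + v).choose u * (b + 1 + u + v) ^ (b + 1)
        = (u + v).choose u * (b + 1 + u + v) * (b + 1 + u + v) ^ b := by ring
      _ ≤ (u + v + 1).choose (u + 1) * (b + 1 + u) * (b + 1 + u + v) ^ b :=
          Nat.mul_le_mul_right _ h1
      _ = (u + v + 1).choose (u + 1) * (b + 1 + u + v) ^ b * (b + 1 + u) := by ring
      _ ≤ (b + 1 + u + v).choose (b + 1 + u) * (b + 1 + u) ^ b * (b + 1 + u) :=
          Nat.mul_le_mul_right _ ih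
      _ = _ := by ring

theorem card_superset_powersetCard_le {m t : ℕ} (hm : 0 < m) (htm : t ≤ m) (B : Finset (Fin m)) :
    (#{A ∈ powersetCard t (univ : Finset (Fin m)) | B ⊆ A} : ℝ) ≤
      m.choose t * ((t : ℝ) / m) ^ #B := by
  by_cases hB : #B ≤ t
  · rw [card_filter_powersetCard_subset B univ t (subset_univ _) hB, div_pow, ← mul_div_assoc,
      le_div_iff₀ (by positivity), card_univ, Fintype.card_fin]
    exact_mod_cast choose_sub_mul_pow_le htm #B hB
  · rw [filter_false_of_mem fun A hA hBA => hB ((card_le_card hBA).trans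
      (mem_powersetCard.1 hA).2.le)]
    simp only [card_empty, Nat.cast_zero]
    positivity

/-- The generating function of the hypergeometric distribution is at most that of the Poisson
distribution with the same mean. -/
theorem sum_pow_card_inter_le {m t : ℕ} (hm : 0 < m) (htm : t ≤ m) (J : Finset (Fin m)) (μ : ℝ)
    (hμ : 0 ≤ μ) :
    ∑ A ∈ powersetCard t univ, (1 + μ) ^ #(A ∩ J) ≤
      m.choose t * Real.exp (μ * (t * #J / m)) := by
  have h1 : ∀ A : Finset (Fin m), (1 + μ) ^ #(A ∩ J) =
      ∑ B ∈ J.powerset, if B ⊆ A then μ ^ #B else 0 := by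
    intro A
    rw [← sum_filter, add_comm, ← sum_pow_mul_eq_add_pow]
    simp only [one_pow, mul_one]
    refine sum_congr ?_ fun _ _ => rfl
    ext B
    simp only [mem_filter, mem_powerset, subset_inter_iff, and_comm]
  simp_rw [h1]
  rw [sum_comm]
  calc ∑ B ∈ J.powerset, ∑ A ∈ powersetCard t univ, (if B ⊆ A then μ ^ #B else 0)
      ≤ ∑ B ∈ J.powerset, m.choose t * (μ * (t / m)) ^ #B := by
        refine sum_le_sum fun B _ => ?_
        rw [← sum_filter, sum_const, nsmul_eq_mul, mul_pow, mul_left_comm, mul_comm]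
        exact mul_le_mul_of_nonneg_left (card_superset_powersetCard_le hm htm B) (by positivity)
    _ = m.choose t * (μ * (t / m) + 1) ^ #J := by
        rw [← mul_sum, ← sum_pow_mul_eq_add_pow]
        simp
    _ ≤ m.choose t * Real.exp (μ * (t / m)) ^ #J := by
        gcongr
        exact Real.add_one_le_exp _
    _ = m.choose t * Real.exp (μ * (t * #J / m)) := by
        rw [← Real.exp_nat_mul]
        congr 2
        ring

theorem sum_pow_card_inter_sub_one_le {m t : ℕ} (hm : 0 < m) (htm : t ≤ m) (J : Finset (Fin m))
    (l : ℝ) (hl : 1 ≤ l) :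
    ∑ A ∈ powersetCard t univ, l ^ (#(A ∩ J) - 1) ≤
      m.choose t * (1 + (Real.exp ((l - 1) * (t * #J / m)) - 1) / l) := by
  have h := sum_pow_card_inter_le hm htm J (l - 1) (by linarith)
  rw [add_sub_cancel] at h
  have hpt : ∀ d : ℕ, l ^ (d - 1) ≤ (1 - 1 / l) + l ^ d / l := by
    intro d
    have h1 : 1 / l ≤ 1 := by rw [div_le_one (by linarith)]; exact hl
    cases d with
    | zero => simp
    | succ d =>
      have : l ^ (d + 1) / l = l ^ d := by
        rw [pow_succ, mul_div_assoc, div_self (by linarith), mul_one]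
      rw [this, Nat.add_sub_cancel]
      linarith
  calc ∑ A ∈ powersetCard t univ, l ^ (#(A ∩ J) - 1)
      ≤ ∑ A ∈ powersetCard t univ, ((1 - 1 / l) + l ^ #(A ∩ J) / l) :=
        sum_le_sum fun A _ => hpt _
    _ = m.choose t * (1 - 1 / l) + (∑ A ∈ powersetCard t univ, l ^ #(A ∩ J)) / l := by
        rw [sum_add_distrib, sum_div, sum_const, card_powersetCard, card_univ, Fintype.card_fin,
          nsmul_eq_mul]
    _ ≤ m.choose t * (1 - 1 / l) + (m.choose t * Real.exp ((l - 1) * (t * #J / m))) / l := by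
        gcongr
    _ = _ := by ring

theorem sparseChoices_eq_piFinset (n m t : ℕ) :
    sparseChoices n m t = Fintype.piFinset fun _ : Fin n => powersetCard t univ := by
  ext T
  simp [sparseChoices, mem_powersetCard]

theorem card_sparseChoices (n m t : ℕ) : #(sparseChoices n m t) = m.choose t ^ n := by
  rw [sparseChoices_eq_piFinset, Fintype.card_piFinset]
  simp

/-- Markov's inequality for a product of exponential weights of the independent choices. -/
theorem card_sparseChoices_lt_sum_le {n m t : ℕ} (φ : Finset (Fin m) → ℕ) (a : ℕ) (l M : ℝ)
    (hl : 1 ≤ l) (hM : ∑ A ∈ powersetCard t univ, l ^ φ A ≤ m.choose t * M) :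
    (#{T ∈ sparseChoices n m t | a < ∑ x, φ (T x)} : ℝ) ≤
      #(sparseChoices n m t) * (M ^ n / l ^ a) := by
  have hl0 : 0 < l := by linarith
  rw [← mul_div_assoc, le_div_iff₀ (by positivity), ← nsmul_eq_mul]
  calc #{T ∈ sparseChoices n m t | a < ∑ x, φ (T x)} • l ^ a
      ≤ ∑ T ∈ sparseChoices n m t with a < ∑ x, φ (T x), ∏ x, l ^ φ (T x) := by
        refine card_nsmul_le_sum _ _ _ fun T hT => ?_
        rw [prod_pow_eq_pow_sum]
        exact pow_le_pow_right₀ hl (mem_filter.1 hT).2.le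
    _ ≤ ∑ T ∈ sparseChoices n m t, ∏ x, l ^ φ (T x) :=
        sum_le_sum_of_subset_of_nonneg (filter_subset _ _) fun _ _ _ => by positivity
    _ = (∑ A ∈ powersetCard t univ, l ^ φ A) ^ n := by
        rw [sparseChoices_eq_piFinset, ← prod_univ_sum (fun _ : Fin n => powersetCard t univ)
          (fun _ A => l ^ φ A)]
        simp
    _ ≤ (m.choose t * M) ^ n := pow_le_pow_left₀ (sum_nonneg fun _ _ => by positivity) hM n
    _ = _ := by
        rw [mul_pow, card_sparseChoices]
        push_cast
        ring

theorem card_sparseChoices_dense_le {n m t : ℕ} (ht : 1 ≤ t) (htn : t ≤ n) (hnm : n ≤ m)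
    (J : Finset (Fin m)) (hJ : J.Nonempty) :
    (#{T ∈ sparseChoices n m t | 8 * t * #J < ∑ x, (#(T x ∩ J) - 1)} : ℝ) ≤
      #(sparseChoices n m t) * ((#J : ℝ) / m * Real.exp (1 - 5 * t)) ^ #J := by
  have hm : 0 < m := by omega
  have hk : 0 < #J := hJ.card_pos
  set k := #J with hk_def
  have hmR : (0 : ℝ) < m := by exact_mod_cast hm
  have hkR : (0 : ℝ) < k := by exact_mod_cast hk
  have htR : (1 : ℝ) ≤ t := by exact_mod_cast ht
  have hnmR : (n : ℝ) ≤ m := by exact_mod_cast hnm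
  set q : ℝ := t * k / m with hq
  have hq0 : 0 < q := by positivity
  have hnq : n * q ≤ t * k := by
    rw [hq, ← mul_div_assoc, div_le_iff₀ hmR, mul_comm]
    gcongr
  have hte : (t : ℝ) ≤ Real.exp t := by linarith [Real.add_one_le_exp (t : ℝ)]
  have he2 : (2 : ℝ) ≤ Real.exp 1 := by linarith [Real.add_one_le_exp (1 : ℝ)]
  have he3 : Real.exp 1 ≤ 3 := Real.exp_one_lt_three.le
  have hgoal : q * Real.exp (2 * t + 1 - 8 * t) ≤ (k : ℝ) / m * Real.exp (1 - 5 * t) := by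
    have : Real.exp (1 - 5 * t) = Real.exp t * Real.exp (2 * t + 1 - 8 * t) := by
      rw [← Real.exp_add]; congr 1; ring
    rw [this, hq, mul_comm (t : ℝ), mul_div_right_comm, mul_assoc]
    gcongr
  suffices ∃ l M : ℝ, 1 ≤ l ∧ 0 ≤ M ∧
      ∑ A ∈ powersetCard t univ, l ^ (#(A ∩ J) - 1) ≤ m.choose t * M ∧
      M ^ n / l ^ (8 * t * k) ≤ (q * Real.exp (2 * t + 1 - 8 * t)) ^ k by
    obtain ⟨l, M, hl, hM0, hM, hlM⟩ := this
    refine (card_sparseChoices_lt_sum_le (n := n) (fun A => #(A ∩ J) - 1) (8 * t * k) l M hl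
      hM).trans ?_
    gcongr
    exact hlM.trans (by gcongr)
  by_cases hcase : q * Real.exp 1 ≤ 1
  · refine ⟨1 / q, Real.exp (2 * q), ?_, by positivity, ?_, ?_⟩
    · rw [le_div_iff₀ hq0]
      nlinarith
    · refine (sum_pow_card_inter_sub_one_le hm (htn.trans hnm) J (1 / q) ?_).trans ?_
      · rw [le_div_iff₀ hq0]
        nlinarith
      · gcongr
        have h1 : Real.exp ((1 / q - 1) * q) ≤ Real.exp 1 := by
          gcongr
          have : (1 / q - 1) * q = 1 - q := by field_simp
          linarith
        have h2 := Real.add_one_le_exp (2 * q)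
        rw [div_div_eq_mul_div, div_one]
        nlinarith
    · have hq1 : q ≤ Real.exp (-1) := by
        rw [Real.exp_neg, ← one_div, le_div_iff₀ (Real.exp_pos _)]
        exact hcase
      have h1 : Real.exp (2 * q) ^ n ≤ Real.exp (2 * t) ^ k := by
        rw [← Real.exp_nat_mul, ← Real.exp_nat_mul]
        exact Real.exp_le_exp.2 (by linarith)
      have h2 : q ^ (8 * t) ≤ q * Real.exp (1 - 8 * t) := by
        have h8 : 8 * t = 1 + (8 * t - 1) := by omega
        have h8' : ((8 * t - 1 : ℕ) : ℝ) = 8 * t - 1 := by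
          rw [Nat.cast_sub (by omega)]; push_cast; ring
        rw [h8, pow_add, pow_one]
        have : Real.exp (1 - 8 * t) = Real.exp (-1) ^ (8 * t - 1) := by
          rw [← Real.exp_nat_mul, h8']; congr 1; ring
        rw [this]
        exact mul_le_mul_of_nonneg_left (pow_le_pow_left₀ hq0.le hq1 _) hq0.le
      rw [one_div, inv_pow, div_inv_eq_mul, pow_mul]
      have h3 : q * Real.exp (2 * t + 1 - 8 * t) = Real.exp (2 * t) * (q * Real.exp (1 - 8 * t)) := by
        rw [mul_left_comm, ← Real.exp_add]; congr 2; ring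
      rw [h3, mul_pow]
      gcongr
  · have hcase : 1 < q * Real.exp 1 := not_le.1 hcase
    refine ⟨Real.exp 1, Real.exp (2 * q), by linarith, by positivity, ?_, ?_⟩
    · refine le_trans (sum_le_sum (g := fun A => (1 + (Real.exp 1 - 1)) ^ #(A ∩ J)) fun A _ => ?_)
        ((sum_pow_card_inter_le hm (htn.trans hnm) J (Real.exp 1 - 1) (by linarith)).trans ?_)
      · rw [add_sub_cancel]
        exact pow_le_pow_right₀ (by linarith) (Nat.sub_le _ _)
      · gcongr
        linarith
    · have h1 : Real.exp (2 * q) ^ n ≤ Real.exp (2 * t) ^ k := by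
        rw [← Real.exp_nat_mul, ← Real.exp_nat_mul]
        exact Real.exp_le_exp.2 (by linarith)
      have h2 : Real.exp (2 * t) / Real.exp 1 ^ (8 * t) ≤ q * Real.exp (2 * t + 1 - 8 * t) := by
        have : q * Real.exp (2 * t + 1 - 8 * t) =
            q * Real.exp 1 * (Real.exp (2 * t) / Real.exp 1 ^ (8 * t)) := by
          rw [← Real.exp_nat_mul, ← Real.exp_sub, mul_assoc, ← Real.exp_add]
          congr 2; push_cast; ring
        rw [this]
        exact le_mul_of_one_le_left (by positivity) hcase.le
      calc _ ≤ Real.exp (2 * t) ^ k / (Real.exp 1 ^ (8 * t)) ^ k := by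
            rw [← pow_mul]; gcongr
        _ = (Real.exp (2 * t) / Real.exp 1 ^ (8 * t)) ^ k := by rw [div_pow]
        _ ≤ _ := by gcongr

theorem choose_mul_div_pow_le_exp {m : ℕ} (hm : 0 < m) (k : ℕ) :
    (m.choose k : ℝ) * ((k : ℝ) / m) ^ k ≤ Real.exp 1 ^ k := by
  have h1 : (m.choose k : ℝ) ≤ (m : ℝ) ^ k / k.factorial := Nat.choose_le_pow_div k m
  have h2 := Real.pow_div_factorial_le_exp (x := (k : ℝ)) (by positivity) k
  rw [← Real.exp_nat_mul, mul_one]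
  refine le_trans (le_trans (mul_le_mul_of_nonneg_right h1 (by positivity)) (le_of_eq ?_)) h2
  rw [div_pow]
  field_simp

/-- With probability at least `1 - 2⁻ᵗ`, a random sparse system satisfies the sparsity condition
for all subfamilies simultaneously. -/
theorem card_sparseChoices_exists_dense_le {n m t : ℕ} (ht : 1 ≤ t) (htn : t ≤ n) (hnm : n ≤ m) :
    (#{T ∈ sparseChoices n m t | ∃ J, 8 * t * #J < ∑ x, (#(T x ∩ J) - 1)} : ℝ) ≤
      #(sparseChoices n m t) * (1 / 2) ^ t := by
  have hm : 0 < m := by omega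
  have htR : (1 : ℝ) ≤ t := by exact_mod_cast ht
  let F : ℕ → ℝ := fun k => if k = 0 then 0 else ((k : ℝ) / m * Real.exp (1 - 5 * t)) ^ k
  have hexp : Real.exp 1 * Real.exp (1 - 5 * t) ≤ (1 / 2) ^ t * (1 / 2) := by
    have h2 : Real.exp (-1) ≤ 1 / 2 := by
      rw [Real.exp_neg, ← one_div]
      gcongr
      linarith [Real.add_one_le_exp (1 : ℝ)]
    calc Real.exp 1 * Real.exp (1 - 5 * t) ≤ Real.exp (-1) ^ (t + 1) := by
          rw [← Real.exp_add, ← Real.exp_nat_mul]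
          gcongr
          push_cast
          linarith
      _ ≤ (1 / 2) ^ (t + 1) := by gcongr
      _ = _ := pow_succ _ _
  have hterm : ∀ k, (m.choose k : ℝ) * F k ≤ if k = 0 then 0 else (1 / 2) ^ t * (1 / 2) ^ k := by
    intro k
    by_cases hk : k = 0
    · simp [F, hk]
    · simp only [F, hk, if_false]
      rw [mul_pow, ← mul_assoc]
      calc _ ≤ Real.exp 1 ^ k * Real.exp (1 - 5 * t) ^ k := by
            gcongr
            exact choose_mul_div_pow_le_exp hm k
        _ = (Real.exp 1 * Real.exp (1 - 5 * t)) ^ k := (mul_pow _ _ _).symm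
        _ ≤ ((1 / 2) ^ t * (1 / 2)) ^ k := by gcongr
        _ = ((1 / 2) ^ t) ^ k * (1 / 2) ^ k := mul_pow _ _ _
        _ ≤ (1 / 2) ^ t * (1 / 2) ^ k := by
            gcongr
            exact pow_le_of_le_one (by positivity) (pow_le_one₀ (by norm_num) (by norm_num)) hk
  have hgeom : ∑ k ∈ range (m + 1), (m.choose k : ℝ) * F k ≤ (1 / 2) ^ t := by
    refine (sum_le_sum fun k _ => hterm k).trans ?_
    rw [sum_range_succ']
    simp only [Nat.add_eq_zero_iff, one_ne_zero, and_false, if_false, if_true, add_zero, pow_succ,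
      ← mul_assoc]
    rw [← sum_mul, ← mul_sum]
    have := sum_geometric_two_le (m)
    nlinarith [show (0 : ℝ) < (1 / 2) ^ t by positivity]
  have hunion : (#{T ∈ sparseChoices n m t | ∃ J, 8 * t * #J < ∑ x, (#(T x ∩ J) - 1)} : ℝ) ≤
      ∑ J : Finset (Fin m),
        (#{T ∈ sparseChoices n m t | 8 * t * #J < ∑ x, (#(T x ∩ J) - 1)} : ℝ) := by
    rw [← Nat.cast_sum, Nat.cast_le]
    refine le_trans (card_le_card fun T hT => ?_) card_biUnion_le
    obtain ⟨hT, J, hJ⟩ := mem_filter.1 hT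
    exact mem_biUnion.2 ⟨J, mem_univ _, mem_filter.2 ⟨hT, hJ⟩⟩
  calc _ ≤ ∑ J : Finset (Fin m), #(sparseChoices n m t) * F #J := by
        refine hunion.trans (sum_le_sum fun J _ => ?_)
        obtain rfl | hJ := J.eq_empty_or_nonempty
        · simp [F]
        · simp only [F, hJ.card_ne_zero, if_false]
          exact card_sparseChoices_dense_le ht htn hnm J hJ
    _ = #(sparseChoices n m t) * ∑ k ∈ range (m + 1), (m.choose k : ℝ) * F k := by
        rw [← mul_sum, ← powerset_univ, sum_powerset_apply_card]
        simp
    _ ≤ _ := by gcongr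

theorem local_lemma_condition {t : ℕ} (ht : 128 ≤ t) :
    4 * (2 * Real.exp (-((10 * Real.sqrt (t * Real.log t)) ^ 2 / (4 * (8 * t : ℕ))))) *
      (8 * t * (2 * t) : ℕ) ≤ 1 := by
  have htR : (128 : ℝ) ≤ t := by exact_mod_cast ht
  have hlog : 0 ≤ Real.log t := Real.log_nonneg (by linarith)
  have h1 : Real.exp (-((10 * Real.sqrt (t * Real.log t)) ^ 2 / (4 * (8 * t : ℕ)))) ≤
      1 / (t : ℝ) ^ 3 := by
    have : 1 / (t : ℝ) ^ 3 = Real.exp (-(3 * Real.log t)) := by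
      rw [Real.exp_neg, one_div]
      congr 1
      have := Real.exp_nat_mul (Real.log t) 3
      rw [Real.exp_log (by linarith)] at this
      exact_mod_cast this.symm
    rw [this, mul_pow, Real.sq_sqrt (by positivity)]
    gcongr
    rw [le_div_iff₀ (by positivity)]
    push_cast
    nlinarith [mul_nonneg (show (0 : ℝ) ≤ t by linarith) hlog]
  calc _ ≤ 4 * (2 * (1 / (t : ℝ) ^ 3)) * (8 * t * (2 * t) : ℕ) := by gcongr
    _ = 128 / t := by push_cast; field_simp; norm_num
    _ ≤ 1 := by rw [div_le_one (by linarith)]; exact htR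

/-- For `t ≥ t₀` and `m ≥ n ≥ t`, a random `t`-sparse set system has
`herdisc(Σ) ≤ C √(t log t)` with probability at least `1 - 2^{-t}`. -/
theorem random_herdisc_whp :
    ∃ C : ℝ, 0 < C ∧ ∃ t₀ : ℕ, ∀ t m n : ℕ, t₀ ≤ t → t ≤ n → n ≤ m →
      1 - (2 : ℝ) ^ (-(t : ℤ)) ≤
        (((sparseChoices n m t).filter fun T =>
            (herdisc (setsOf T) : ℝ) ≤ C * Real.sqrt (t * Real.log t)).card : ℝ)
          / (sparseChoices n m t).card := by
  refine ⟨11, by norm_num, 128, fun t m n ht htn hnm => ?_⟩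
  have htR : (128 : ℝ) ≤ t := by exact_mod_cast ht
  have hlog : 1 ≤ Real.log t := by
    rw [Real.le_log_iff_exp_le (by linarith)]
    linarith [Real.exp_one_lt_three]
  have hsqrt : 1 ≤ Real.sqrt (t * Real.log t) := by
    rw [Real.one_le_sqrt]
    nlinarith
  have hN : (0 : ℝ) < #(sparseChoices n m t) := by
    rw [card_sparseChoices]
    exact_mod_cast pow_pos (Nat.choose_pos (htn.trans hnm)) n
  have hbad := card_sparseChoices_exists_dense_le (by omega) htn hnm
  have hgood : (#(sparseChoices n m t) : ℝ) ≤
      #{T ∈ sparseChoices n m t | (herdisc (setsOf T) : ℝ) ≤ 11 * Real.sqrt (t * Real.log t)} +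
      #{T ∈ sparseChoices n m t | ∃ J, 8 * t * #J < ∑ x, (#(T x ∩ J) - 1)} := by
    rw [← Nat.cast_add, Nat.cast_le]
    refine le_trans (card_le_card fun T hT => ?_) (card_union_le _ _)
    rw [mem_union, mem_filter, mem_filter]
    by_cases hJ : ∃ J, 8 * t * #J < ∑ x, (#(T x ∩ J) - 1)
    · exact Or.inr ⟨hT, hJ⟩
    · push Not at hJ
      refine Or.inl ⟨hT, ?_⟩
      have := herdisc_setsOf_le T t (8 * t) (by omega) (by omega) (mem_filter.1 hT).2 hJ
        (10 * Real.sqrt (t * Real.log t)) (by positivity) (local_lemma_condition ht)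
      linarith
  have hpow : (2 : ℝ) ^ (-(t : ℤ)) = (1 / 2) ^ t := by
    rw [zpow_neg, zpow_natCast, one_div, inv_pow]
  rw [hpow, le_div_iff₀ hN]
  linarith
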